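/- Let the pairs (U₁,V₁) and (U₂,V₂) of bounded linear operators on H satisfy the symplectic relations, set (U₃,V₃) := (U₂U₁ + V₂V̄₁, U₂V₁ + V₂Ū₁), and let Z be a transposition-symmetric bounded operator with ‖Z‖ < 1. Then the Siegel-disc action satisfies the cocycle identity ζ(U₂,V₂; ζ(U₁,V₁; Z)) = ζ(U₃,V₃; Z). -/

import Mathlib

open ContinuousLinearMap
open scoped InnerProductSpace

variable {H : Type*} [NormedAddCommGroup H] [InnerProductSpace ℂ H] [CompleteSpace H]

/-- The complex conjugate `Ā := J ∘ A ∘ J` of a bounded operator with respect to the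
conjugation `J`. -/
noncomputable def conjOp (J : H →L⋆[ℂ] H) (A : H →L[ℂ] H) : H →L[ℂ] H :=
  (J.comp A).comp J

/-- The transpose `Aᵀ := J ∘ A* ∘ J` of a bounded operator with respect to the
conjugation `J`. -/
noncomputable def transp (J : H →L⋆[ℂ] H) (A : H →L[ℂ] H) : H →L[ℂ] H :=
  conjOp J (adjoint A)

/-- The pair `(U, V)` satisfies the symplectic relations:
`U U* − V V* = 1`, `U Vᵀ = V Uᵀ`, `U* U − Vᵀ V̄ = 1`, `Uᵀ V̄ = V* U`. -/
def SymplecticPair (J : H →L⋆[ℂ] H) (U V : H →L[ℂ] H) : Prop :=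
  U ∘L adjoint U - V ∘L adjoint V = 1 ∧
  U ∘L transp J V = V ∘L transp J U ∧
  adjoint U ∘L U - transp J V ∘L conjOp J V = 1 ∧
  transp J U ∘L conjOp J V = adjoint V ∘L U

/-- The Siegel-disc action `ζ(U,V; Z) := (U* + Z V*)⁻¹ (Vᵀ + Z Uᵀ)`. -/
noncomputable def zeta (J : H →L⋆[ℂ] H) (U V Z : H →L[ℂ] H) : H →L[ℂ] H :=
  Ring.inverse (adjoint U + Z ∘L adjoint V) ∘L (transp J V + Z ∘L transp J U)

lemma inner_conjugation_apply (J : H →L⋆[ℂ] H) (hJnorm : ∀ x, ‖J x‖ = ‖x‖) (x y : H) :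
    ⟪J x, J y⟫_ℂ = ⟪y, x⟫_ℂ := by
  have hre (a b : H) : (⟪J a, J b⟫_ℂ).re = (⟪a, b⟫_ℂ).re := by
    have h := norm_add_sq (𝕜 := ℂ) (J a) (J b)
    rw [← map_add, hJnorm, hJnorm, hJnorm, norm_add_sq (𝕜 := ℂ) a b] at h
    simp only [RCLike.re_to_complex] at h
    linarith
  rw [← inner_conj_symm y x]
  apply Complex.ext
  · rw [Complex.conj_re]
    exact hre x y
  · rw [Complex.conj_im]
    simpa [-inner_conj_symm, inner_smul_right] using hre x (Complex.I • y)

lemma adjoint_conjOp (J : H →L⋆[ℂ] H) (hJinv : ∀ x, J (J x) = x) (hJnorm : ∀ x, ‖J x‖ = ‖x‖)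
    (A : H →L[ℂ] H) : adjoint (conjOp J A) = transp J A := by
  symm
  rw [eq_adjoint_iff]
  intro x y
  calc ⟪J (adjoint A (J x)), y⟫_ℂ = ⟪J (adjoint A (J x)), J (J y)⟫_ℂ := by rw [hJinv]
    _ = ⟪A (J y), J x⟫_ℂ := by rw [inner_conjugation_apply J hJnorm, adjoint_inner_right]
    _ = ⟪J (J x), J (A (J y))⟫_ℂ := (inner_conjugation_apply J hJnorm _ _).symm
    _ = ⟪x, J (A (J y))⟫_ℂ := by rw [hJinv]

lemma transp_conjOp (J : H →L⋆[ℂ] H) (hJinv : ∀ x, J (J x) = x) (hJnorm : ∀ x, ‖J x‖ = ‖x‖)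
    (A : H →L[ℂ] H) : transp J (conjOp J A) = adjoint A := by
  ext x
  rw [transp, adjoint_conjOp J hJinv hJnorm]
  simp [transp, conjOp, hJinv]

lemma transp_add (J : H →L⋆[ℂ] H) (A B : H →L[ℂ] H) :
    transp J (A + B) = transp J A + transp J B := by
  ext x
  simp [transp, conjOp]

lemma transp_comp (J : H →L⋆[ℂ] H) (hJinv : ∀ x, J (J x) = x) (A B : H →L[ℂ] H) :
    transp J (A ∘L B) = transp J B ∘L transp J A := by
  ext x
  simp [transp, conjOp, adjoint_comp, hJinv]

lemma isUnit_one_add_mul_star (A : H →L[ℂ] H) : IsUnit (1 + A * star A) :=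
  CStarAlgebra.isUnit_of_le 1 (le_add_of_nonneg_right (mul_star_self_nonneg A))

lemma SymplecticPair.isUnit_adjoint_left {J : H →L⋆[ℂ] H} (hJinv : ∀ x, J (J x) = x)
    (hJnorm : ∀ x, ‖J x‖ = ‖x‖) {U V : H →L[ℂ] H} (h : SymplecticPair J U V) :
    IsUnit (adjoint U) := by
  have hUUs : IsUnit (U * star U) := by
    have := isUnit_one_add_mul_star V
    rwa [show (1 : H →L[ℂ] H) + V * star V = U * star U from
      (sub_eq_iff_eq_add.mp h.1).symm] at this
  have hUsU : IsUnit (star U * U) := by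
    have := isUnit_one_add_mul_star (transp J V)
    rw [← adjoint_conjOp J hJinv hJnorm, star_eq_adjoint, adjoint_adjoint] at this
    have h3 := h.2.2.1
    rw [← adjoint_conjOp J hJinv hJnorm] at h3
    rwa [show (1 : H →L[ℂ] H) + adjoint (conjOp J V) * conjOp J V = star U * U from
      (sub_eq_iff_eq_add.mp h3).symm] at this
  obtain ⟨a, ha⟩ := hUUs
  obtain ⟨b, hb⟩ := hUsU
  refine isUnit_iff_exists_and_exists.mpr ⟨⟨U * ↑b⁻¹, ?_⟩, ⟨↑a⁻¹ * U, ?_⟩⟩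
  · rw [← star_eq_adjoint, ← mul_assoc, ← hb, Units.mul_inv]
  · rw [← star_eq_adjoint, mul_assoc, ← ha, Units.inv_mul]

lemma SymplecticPair.norm_adjoint_right_apply_le {J : H →L⋆[ℂ] H} {U V : H →L[ℂ] H}
    (h : SymplecticPair J U V) (x : H) : ‖adjoint V x‖ ≤ ‖adjoint U x‖ := by
  have hx : ⟪U (adjoint U x), x⟫_ℂ = ⟪x, x⟫_ℂ + ⟪V (adjoint V x), x⟫_ℂ := by
    rw [← inner_add_left]
    congr 1
    exact congrArg (fun A : H →L[ℂ] H => A x) (sub_eq_iff_eq_add.mp h.1)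
  simp only [← adjoint_inner_right, inner_self_eq_norm_sq_to_K] at hx
  norm_cast at hx
  refine (sq_le_sq₀ (norm_nonneg _) (norm_nonneg _)).mp ?_
  nlinarith [sq_nonneg ‖x‖]

/-- The denominator of the Siegel-disc action is invertible on the open unit disc. -/
lemma SymplecticPair.isUnit_denominator {J : H →L⋆[ℂ] H} (hJinv : ∀ x, J (J x) = x)
    (hJnorm : ∀ x, ‖J x‖ = ‖x‖) {U V : H →L[ℂ] H} (h : SymplecticPair J U V)
    {Z : H →L[ℂ] H} (hZ : ‖Z‖ < 1) : IsUnit (adjoint U + Z ∘L adjoint V) := by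
  obtain ⟨u, hu⟩ := h.isUnit_adjoint_left hJinv hJnorm
  set W : H →L[ℂ] H := adjoint V * ↑u⁻¹ with hW
  have hWnorm : ‖W‖ ≤ 1 := by
    refine opNorm_le_bound _ zero_le_one fun y => ?_
    calc ‖W y‖ ≤ ‖adjoint U ((↑u⁻¹ : H →L[ℂ] H) y)‖ := h.norm_adjoint_right_apply_le _
      _ = ‖((u : H →L[ℂ] H) * ↑u⁻¹) y‖ := by rw [hu]; rfl
      _ = 1 * ‖y‖ := by simp
  have hlt : ‖-(Z * W)‖ < 1 := by
    rw [norm_neg]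
    calc ‖Z * W‖ ≤ ‖Z‖ * ‖W‖ := norm_mul_le _ _
      _ ≤ ‖Z‖ * 1 := by gcongr
      _ < 1 := by rwa [mul_one]
  have hunit := (isUnit_one_sub_of_norm_lt_one hlt).mul u.isUnit
  have heq : (1 - -(Z * W)) * (u : H →L[ℂ] H) = adjoint U + Z ∘L adjoint V := by
    rw [sub_neg_eq_add, add_mul, one_mul, hW, mul_assoc, Units.inv_mul_cancel_right, hu]
    rfl
  rwa [heq] at hunit

lemma Ring.inverse_mul_mul_left_of_isUnit {R : Type*} [Ring R] {d : R} (hd : IsUnit d)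
    (x y : R) : Ring.inverse (d * x) * (d * y) = Ring.inverse x * y := by
  rw [Ring.inverse_mul (.inl hd), mul_assoc, Ring.inverse_mul_cancel_left _ _ hd]

/-- The Siegel-disc action satisfies the cocycle identity
`ζ(U₂,V₂; ζ(U₁,V₁; Z)) = ζ(U₃,V₃; Z)` where `(U₃,V₃) = (U₂U₁ + V₂V̄₁, U₂V₁ + V₂Ū₁)`. -/
theorem statement13 (J : H →L⋆[ℂ] H) (hJinv : ∀ x, J (J x) = x) (hJnorm : ∀ x, ‖J x‖ = ‖x‖)
    (U₁ V₁ U₂ V₂ : H →L[ℂ] H)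
    (h1 : SymplecticPair J U₁ V₁) (h2 : SymplecticPair J U₂ V₂)
    (Z : H →L[ℂ] H) (hZsym : Z = transp J Z) (hZ : ‖Z‖ < 1) :
    zeta J U₂ V₂ (zeta J U₁ V₁ Z)
      = zeta J (U₂ ∘L U₁ + V₂ ∘L conjOp J V₁) (U₂ ∘L V₁ + V₂ ∘L conjOp J U₁) Z := by
  have hD := h1.isUnit_denominator hJinv hJnorm hZ
  have hζ : (adjoint U₁ + Z ∘L adjoint V₁) * zeta J U₁ V₁ Z
      = transp J V₁ + Z ∘L transp J U₁ :=
    Ring.mul_inverse_cancel_left _ _ hD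
  have hden : adjoint (U₂ ∘L U₁ + V₂ ∘L conjOp J V₁)
        + Z ∘L adjoint (U₂ ∘L V₁ + V₂ ∘L conjOp J U₁)
      = (adjoint U₁ + Z ∘L adjoint V₁) * (adjoint U₂ + zeta J U₁ V₁ Z * adjoint V₂) := by
    rw [mul_add, ← mul_assoc, hζ]
    simp only [map_add, adjoint_comp, adjoint_conjOp J hJinv hJnorm]
    simp only [← mul_def]
    noncomm_ring
  have hnum : transp J (U₂ ∘L V₁ + V₂ ∘L conjOp J U₁)
        + Z ∘L transp J (U₂ ∘L U₁ + V₂ ∘L conjOp J V₁)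
      = (adjoint U₁ + Z ∘L adjoint V₁) * (transp J V₂ + zeta J U₁ V₁ Z * transp J U₂) := by
    rw [mul_add, ← mul_assoc, hζ]
    simp only [transp_add, transp_comp J hJinv, transp_conjOp J hJinv hJnorm]
    simp only [← mul_def]
    noncomm_ring
  conv_rhs => rw [zeta, hden, hnum]
  exact (Ring.inverse_mul_mul_left_of_isUnit hD _ _).symm
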